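/- If an atomic flow A is cycle-free and A →_c* B, then B is cycle-free. -/

import Mathlib

set_option linter.unusedVariables false

namespace AF

/-! ### Formulae of system SKS.

Atoms are pairs `(n, b)`; the involution `ā` flips the Boolean, so it is
fixed-point free. -/

inductive Formula : Type
  | tt : Formula
  | ff : Formula
  | atom : ℕ → Bool → Formula
  | or : Formula → Formula → Formula
  | and : Formula → Formula → Formula
  deriving DecidableEq

namespace Formula

/-- Subformula at a position (`false` = left child, `true` = right child). -/
def sub : Formula → List Bool → Option Formula
  | φ, [] => some φ
  | .or α _, false :: p => sub α p
  | .or _ β, true :: p => sub β p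
  | .and α _, false :: p => sub α p
  | .and _ β, true :: p => sub β p
  | _, _ :: _ => none

/-- Replace the subformula at a position. -/
def repl : Formula → List Bool → Formula → Formula
  | _, [], ψ => ψ
  | .or α β, false :: p, ψ => .or (repl α p ψ) β
  | .or α β, true :: p, ψ => .or α (repl β p ψ)
  | .and α β, false :: p, ψ => .and (repl α p ψ) β
  | .and α β, true :: p, ψ => .and α (repl β p ψ)
  | φ, _ :: _, _ => φ

/-- `p` is an atom occurrence of `φ`. -/
def IsOcc (φ : Formula) (p : List Bool) : Prop :=
  ∃ n b, φ.sub p = some (.atom n b)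

end Formula

/-! ### Inference rules.

The rule `=` of SKS replaces a formula by an equivalent one under
commutativity, associativity and the unit equations; each single instance of
`=` applies one equation (in either direction), so we list the equations as
individual rule names, all marked as being instances of `=` via `isEq`. -/

inductive RuleName : Type
  | aiDown | aiUp | awDown | awUp | acDown | acUp
  | s | m
  | eqOrComm | eqAndComm
  | eqOrAssocL | eqOrAssocR | eqAndAssocL | eqAndAssocR
  | eqOrUnitDel | eqOrUnitAdd | eqAndUnitDel | eqAndUnitAdd
  | eqTTDel | eqTTAdd | eqFFDel | eqFFAdd
  deriving DecidableEq

namespace RuleName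

/-- The atomic structural rules. -/
def isStructural : RuleName → Bool
  | .aiDown | .aiUp | .awDown | .awUp | .acDown | .acUp => true
  | _ => false

/-- The rule names that are instances of the rule `=`. -/
def isEq : RuleName → Bool
  | .aiDown | .aiUp | .awDown | .awUp | .acDown | .acUp | .s | .m => false
  | _ => true

end RuleName

/-- Rule instances (redex ⟹ contractum). -/
inductive RuleInstance : RuleName → Formula → Formula → Prop
  | aiDown (n : ℕ) (b : Bool) :
      RuleInstance .aiDown .tt (.or (.atom n b) (.atom n (!b)))
  | aiUp (n : ℕ) (b : Bool) :
      RuleInstance .aiUp (.and (.atom n b) (.atom n (!b))) .ff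
  | awDown (n : ℕ) (b : Bool) : RuleInstance .awDown .ff (.atom n b)
  | awUp (n : ℕ) (b : Bool) : RuleInstance .awUp (.atom n b) .tt
  | acDown (n : ℕ) (b : Bool) :
      RuleInstance .acDown (.or (.atom n b) (.atom n b)) (.atom n b)
  | acUp (n : ℕ) (b : Bool) :
      RuleInstance .acUp (.atom n b) (.and (.atom n b) (.atom n b))
  | s (α β γ : Formula) :
      RuleInstance .s (.and α (.or β γ)) (.or (.and α β) γ)
  | m (α β γ δ : Formula) :
      RuleInstance .m (.or (.and α β) (.and γ δ)) (.and (.or α γ) (.or β δ))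
  | eqOrComm (α β : Formula) : RuleInstance .eqOrComm (.or α β) (.or β α)
  | eqAndComm (α β : Formula) : RuleInstance .eqAndComm (.and α β) (.and β α)
  | eqOrAssocL (α β γ : Formula) :
      RuleInstance .eqOrAssocL (.or (.or α β) γ) (.or α (.or β γ))
  | eqOrAssocR (α β γ : Formula) :
      RuleInstance .eqOrAssocR (.or α (.or β γ)) (.or (.or α β) γ)
  | eqAndAssocL (α β γ : Formula) :
      RuleInstance .eqAndAssocL (.and (.and α β) γ) (.and α (.and β γ))
  | eqAndAssocR (α β γ : Formula) :
      RuleInstance .eqAndAssocR (.and α (.and β γ)) (.and (.and α β) γ)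
  | eqOrUnitDel (α : Formula) : RuleInstance .eqOrUnitDel (.or α .ff) α
  | eqOrUnitAdd (α : Formula) : RuleInstance .eqOrUnitAdd α (.or α .ff)
  | eqAndUnitDel (α : Formula) : RuleInstance .eqAndUnitDel (.and α .tt) α
  | eqAndUnitAdd (α : Formula) : RuleInstance .eqAndUnitAdd α (.and α .tt)
  | eqTTDel : RuleInstance .eqTTDel (.or .tt .tt) .tt
  | eqTTAdd : RuleInstance .eqTTAdd .tt (.or .tt .tt)
  | eqFFDel : RuleInstance .eqFFDel (.and .ff .ff) .ff
  | eqFFAdd : RuleInstance .eqFFAdd .ff (.and .ff .ff)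

/-- One (deep) inference step applying rule `r` at position `q`. -/
def StepAt (r : RuleName) (q : List Bool) (φ ψ : Formula) : Prop :=
  ∃ γ δ, φ.sub q = some γ ∧ RuleInstance r γ δ ∧ ψ = φ.repl q δ

/-- One inference step using a rule from the set `S`. -/
def Step (S : Set RuleName) (φ ψ : Formula) : Prop :=
  ∃ r ∈ S, ∃ q, StepAt r q φ ψ

/-- There is a derivation from `φ` to `ψ` using only rules from `S`. -/
def Derives (S : Set RuleName) : Formula → Formula → Prop :=
  Relation.ReflTransGen (Step S)

/-! ### Derivations as explicit data (for the theory of atomic flows). -/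

/-- A derivation: a premiss and a chain of steps, each recorded by its rule
name, the position of the redex, and the resulting formula. -/
structure Deriv : Type where
  prem : Formula
  steps : List (RuleName × List Bool × Formula)

namespace Deriv

/-- The `i`-th step datum. -/
def stepAt (Φ : Deriv) (i : ℕ) : RuleName × List Bool × Formula :=
  Φ.steps.getD i (RuleName.s, ([] : List Bool), Formula.tt)

/-- The `i`-th formula of the derivation (`0` is the premiss). -/
def fml (Φ : Deriv) (i : ℕ) : Formula :=
  (Φ.prem :: Φ.steps.map (fun t => t.2.2)).getD i Φ.prem

/-- Number of formulae in the derivation. -/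
def nf (Φ : Deriv) : ℕ := Φ.steps.length + 1

/-- The conclusion of the derivation. -/
def concl (Φ : Deriv) : Formula := Φ.fml Φ.steps.length

/-- The derivation is well formed: every recorded step is a correct
inference step of SKS. -/
def WF (Φ : Deriv) : Prop :=
  ∀ i, i < Φ.steps.length →
    StepAt (Φ.stepAt i).1 (Φ.stepAt i).2.1 (Φ.fml i) (Φ.fml (i + 1))

end Deriv

/-! ### Atomic flows. -/

inductive FlowLabel : Type
  | aiDown | aiUp | awDown | awUp | acDown | acUp
  deriving DecidableEq

/-- Required (number of lower edges, number of upper edges) of a vertex. -/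
def labDeg : FlowLabel → ℕ × ℕ
  | .aiDown => (2, 0)
  | .aiUp => (0, 2)
  | .awDown => (1, 0)
  | .awUp => (0, 1)
  | .acDown => (1, 2)
  | .acUp => (2, 1)

/-- The data of an atomic flow: vertices, edges, labels, and the two
endpoint maps.  `up e = none` means the upper endpoint is `⊤`, and
`lo e = none` means the lower endpoint is `⊥`. -/
structure PreFlow : Type where
  V : Finset ℕ
  E : Finset ℕ
  η : ℕ → FlowLabel
  up : ℕ → Option ℕ
  lo : ℕ → Option ℕ

namespace PreFlow

/-- Lower edges of a vertex. -/
def Ledges (F : PreFlow) (v : ℕ) : Finset ℕ :=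
  F.E.filter (fun e => F.up e = some v)

/-- Upper edges of a vertex. -/
def Uedges (F : PreFlow) (v : ℕ) : Finset ℕ :=
  F.E.filter (fun e => F.lo e = some v)

/-- All edges of a vertex. -/
def edges (F : PreFlow) (v : ℕ) : Finset ℕ := F.Ledges v ∪ F.Uedges v

def degOK (F : PreFlow) : Prop :=
  ∀ v ∈ F.V, (F.Ledges v).card = (labDeg (F.η v)).1 ∧
    (F.Uedges v).card = (labDeg (F.η v)).2

def endpointsOK (F : PreFlow) : Prop :=
  ∀ e ∈ F.E, (∀ v, F.up e = some v → v ∈ F.V) ∧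
    (∀ v, F.lo e = some v → v ∈ F.V)

/-- No cyclic sequence of edges `ε₁, …, ε_h` with
`up (ε_i) = lo (ε_(i+1 mod h))`. -/
def Acyclic (F : PreFlow) : Prop :=
  ¬ ∃ (h : ℕ) (ε : Fin (h + 1) → ℕ), (∀ i, ε i ∈ F.E) ∧
      ∀ i : Fin (h + 1), (F.up (ε i)).isSome ∧ F.up (ε i) = F.lo (ε (i + 1))

/-- `π` is a polarity assignment (`false` = `−`, `true` = `+`). -/
def PolarityOK (F : PreFlow) (π : ℕ → Bool) : Prop :=
  ∀ v ∈ F.V,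
    ((F.η v = .acDown ∨ F.η v = .acUp) →
      ∀ e₁ ∈ F.edges v, ∀ e₂ ∈ F.edges v, π e₁ = π e₂) ∧
    ((F.η v = .aiDown ∨ F.η v = .aiUp) →
      ∃ e₁ ∈ F.edges v, ∃ e₂ ∈ F.edges v, π e₁ ≠ π e₂)

/-- `F` is an atomic flow. -/
def IsFlow (F : PreFlow) : Prop :=
  F.degOK ∧ F.endpointsOK ∧ F.Acyclic ∧ ∃ π, F.PolarityOK π

end PreFlow

/-! ### Paths, ai-paths, cycles. -/

/-- An endpoint of a path: a vertex, or `⊤`, or `⊥`. -/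
inductive VPt : Type
  | ver : ℕ → VPt
  | top : VPt
  | bot : VPt
  deriving DecidableEq

/-- The upper endpoint of edge `e` is `ν`. -/
def srcOK (F : PreFlow) (ν : VPt) (e : ℕ) : Prop :=
  match ν with
  | .ver v => F.up e = some v
  | .top => F.up e = none
  | .bot => False

/-- The lower endpoint of edge `e` is `ν`. -/
def tgtOK (F : PreFlow) (ν : VPt) (e : ℕ) : Prop :=
  match ν with
  | .ver v => F.lo e = some v
  | .bot => F.lo e = none
  | .top => False

/-- A downward path from `ν` to `ν'` (a nonempty sequence of edges, each
hanging from the lower endpoint of the previous one). -/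
def IsDownPath (F : PreFlow) (ν ν' : VPt) (l : List ℕ) : Prop :=
  l ≠ [] ∧ (∀ e ∈ l, e ∈ F.E) ∧
  (∀ i, i + 1 < l.length →
    ∃ v ∈ F.V, F.lo (l.getD i 0) = some v ∧ F.up (l.getD (i + 1) 0) = some v) ∧
  srcOK F ν (l.getD 0 0) ∧ tgtOK F ν' (l.getD (l.length - 1) 0)

/-- A path from `ν` to `ν'`: a downward path, or the reverse of a
downward path from `ν'` to `ν`. -/
def IsPath (F : PreFlow) (ν ν' : VPt) (l : List ℕ) : Prop :=
  IsDownPath F ν ν' l ∨ IsDownPath F ν' ν l.reverse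

/-- ai-paths: paths, closed under concatenation (in distinct edges) at
interaction and cointeraction vertices. -/
inductive AIPath (F : PreFlow) : VPt → VPt → List ℕ → Prop
  | single {ν ν' : VPt} {l : List ℕ} : IsPath F ν ν' l → AIPath F ν ν' l
  | join {ν ν' : VPt} {v : ℕ} {l₁ l₂ : List ℕ} {e e' : ℕ} :
      v ∈ F.V → (F.η v = .aiDown ∨ F.η v = .aiUp) →
      AIPath F ν (.ver v) (l₁ ++ [e]) →
      AIPath F (.ver v) ν' (e' :: l₂) →
      e ≠ e' →
      AIPath F ν ν' (l₁ ++ [e] ++ e' :: l₂)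

/-- The flow contains an ai-cycle: an ai-path from a vertex to itself in
which no edge appears twice. -/
def HasAICycle (F : PreFlow) : Prop :=
  ∃ v l, v ∈ F.V ∧ AIPath F (.ver v) (.ver v) l ∧ l.Nodup

def CycleFree (F : PreFlow) : Prop := ¬ HasAICycle F

/-- An ai-connection: a path from an interaction vertex to a cointeraction
vertex or vice versa. -/
def IsConnection (F : PreFlow) (l : List ℕ) : Prop :=
  ∃ v v', v ∈ F.V ∧ v' ∈ F.V ∧
    ((F.η v = .aiDown ∧ F.η v' = .aiUp) ∨
     (F.η v = .aiUp ∧ F.η v' = .aiDown)) ∧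
    IsPath F (.ver v) (.ver v') l

/-- A simple edge: an ai-connection consisting of a single edge. -/
def SimpleEdge (F : PreFlow) (e : ℕ) : Prop := IsConnection F [e]

/-- A clean path: an ai-path all of whose ai-connections are simple edges. -/
def IsCleanPath (F : PreFlow) (ν ν' : VPt) (l : List ℕ) : Prop :=
  AIPath F ν ν' l ∧
  ∀ l₁ l₂ l₃, l = l₁ ++ l₂ ++ l₃ → IsConnection F l₂ → l₂.length = 1

/-! ### Local flow reduction rules. -/

open PreFlow

/-- Rule `w↓-c↓`: a weakening feeding a contraction is erased, merging the
contraction's other two edges. -/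
def RedWdCd (A B : PreFlow) : Prop :=
  ∃ v₁ v₂ e e₂ e₃,
    v₁ ∈ A.V ∧ v₂ ∈ A.V ∧ v₁ ≠ v₂ ∧
    A.η v₁ = .awDown ∧ A.η v₂ = .acDown ∧
    e ∈ A.E ∧ e₂ ∈ A.E ∧ e₃ ∈ A.E ∧ e ≠ e₂ ∧ e ≠ e₃ ∧ e₂ ≠ e₃ ∧
    A.up e = some v₁ ∧ A.lo e = some v₂ ∧
    A.lo e₂ = some v₂ ∧ A.up e₃ = some v₂ ∧
    B.V = (A.V.erase v₁).erase v₂ ∧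
    B.E = (A.E.erase e).erase e₃ ∧
    B.η = A.η ∧ B.up = A.up ∧
    B.lo = Function.update A.lo e₂ (A.lo e₃)

/-- Rule `c↑-w↑` (dual of `w↓-c↓`). -/
def RedCuWu (A B : PreFlow) : Prop :=
  ∃ v₁ v₂ e e₂ e₃,
    v₁ ∈ A.V ∧ v₂ ∈ A.V ∧ v₁ ≠ v₂ ∧
    A.η v₁ = .awUp ∧ A.η v₂ = .acUp ∧
    e ∈ A.E ∧ e₂ ∈ A.E ∧ e₃ ∈ A.E ∧ e ≠ e₂ ∧ e ≠ e₃ ∧ e₂ ≠ e₃ ∧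
    A.lo e = some v₁ ∧ A.up e = some v₂ ∧
    A.up e₂ = some v₂ ∧ A.lo e₃ = some v₂ ∧
    B.V = (A.V.erase v₁).erase v₂ ∧
    B.E = (A.E.erase e).erase e₃ ∧
    B.η = A.η ∧ B.lo = A.lo ∧
    B.up = Function.update A.up e₂ (A.up e₃)

/-- Rule `w↓-i↑`: a weakening feeding a cointeraction is replaced by a
coweakening on the other cointeraction edge. -/
def RedWdIu (A B : PreFlow) : Prop :=
  ∃ v₁ v₂ e e₂,
    v₁ ∈ A.V ∧ v₂ ∈ A.V ∧ v₁ ≠ v₂ ∧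
    A.η v₁ = .awDown ∧ A.η v₂ = .aiUp ∧
    e ∈ A.E ∧ e₂ ∈ A.E ∧ e ≠ e₂ ∧
    A.up e = some v₁ ∧ A.lo e = some v₂ ∧ A.lo e₂ = some v₂ ∧
    B.V = A.V.erase v₁ ∧ B.E = A.E.erase e ∧
    B.η = Function.update A.η v₂ .awUp ∧
    B.up = A.up ∧ B.lo = A.lo

/-- Rule `i↓-w↑` (dual of `w↓-i↑`). -/
def RedIdWu (A B : PreFlow) : Prop :=
  ∃ v₁ v₂ e e₂,
    v₁ ∈ A.V ∧ v₂ ∈ A.V ∧ v₁ ≠ v₂ ∧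
    A.η v₁ = .awUp ∧ A.η v₂ = .aiDown ∧
    e ∈ A.E ∧ e₂ ∈ A.E ∧ e ≠ e₂ ∧
    A.lo e = some v₁ ∧ A.up e = some v₂ ∧ A.up e₂ = some v₂ ∧
    B.V = A.V.erase v₁ ∧ B.E = A.E.erase e ∧
    B.η = Function.update A.η v₂ .awDown ∧
    B.up = A.up ∧ B.lo = A.lo

/-- Rule `w↓-w↑`: a weakening joined to a coweakening is erased. -/
def RedWdWu (A B : PreFlow) : Prop :=
  ∃ v₁ v₂ e,
    v₁ ∈ A.V ∧ v₂ ∈ A.V ∧ v₁ ≠ v₂ ∧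
    A.η v₁ = .awDown ∧ A.η v₂ = .awUp ∧
    e ∈ A.E ∧ A.up e = some v₁ ∧ A.lo e = some v₂ ∧
    B.V = (A.V.erase v₁).erase v₂ ∧ B.E = A.E.erase e ∧
    B.η = A.η ∧ B.up = A.up ∧ B.lo = A.lo

/-- Rule `w↓-c↑`: a weakening feeding a cocontraction is replaced by two
weakenings. -/
def RedWdCu (A B : PreFlow) : Prop :=
  ∃ v₁ v₂ e e₁ e₂,
    v₁ ∈ A.V ∧ v₂ ∈ A.V ∧ v₁ ≠ v₂ ∧
    A.η v₁ = .awDown ∧ A.η v₂ = .acUp ∧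
    e ∈ A.E ∧ e₁ ∈ A.E ∧ e₂ ∈ A.E ∧ e ≠ e₁ ∧ e ≠ e₂ ∧ e₁ ≠ e₂ ∧
    A.up e = some v₁ ∧ A.lo e = some v₂ ∧
    A.up e₁ = some v₂ ∧ A.up e₂ = some v₂ ∧
    B.V = A.V ∧ B.E = A.E.erase e ∧
    B.η = Function.update A.η v₂ .awDown ∧
    B.up = Function.update A.up e₁ (some v₁) ∧
    B.lo = A.lo

/-- Rule `c↓-w↑` (dual of `w↓-c↑`). -/
def RedCdWu (A B : PreFlow) : Prop :=
  ∃ v₁ v₂ e e₁ e₂,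
    v₁ ∈ A.V ∧ v₂ ∈ A.V ∧ v₁ ≠ v₂ ∧
    A.η v₁ = .awUp ∧ A.η v₂ = .acDown ∧
    e ∈ A.E ∧ e₁ ∈ A.E ∧ e₂ ∈ A.E ∧ e ≠ e₁ ∧ e ≠ e₂ ∧ e₁ ≠ e₂ ∧
    A.lo e = some v₁ ∧ A.up e = some v₂ ∧
    A.lo e₁ = some v₂ ∧ A.lo e₂ = some v₂ ∧
    B.V = A.V ∧ B.E = A.E.erase e ∧
    B.η = Function.update A.η v₂ .awUp ∧
    B.lo = Function.update A.lo e₁ (some v₁) ∧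
    B.up = A.up

/-- Rule `c↓-i↑`: a contraction whose output edge enters a cointeraction is
replaced by a cocontraction on the other cointeraction edge followed by two
cointeractions. -/
def RedCdIu (A B : PreFlow) : Prop :=
  ∃ v₁ v₂ v₃ e e₁ e₂ e₃ g₁ g₂,
    v₁ ∈ A.V ∧ v₂ ∈ A.V ∧ v₁ ≠ v₂ ∧ v₃ ∉ A.V ∧
    A.η v₁ = .acDown ∧ A.η v₂ = .aiUp ∧
    e ∈ A.E ∧ e₁ ∈ A.E ∧ e₂ ∈ A.E ∧ e₃ ∈ A.E ∧
    e ≠ e₁ ∧ e ≠ e₂ ∧ e ≠ e₃ ∧ e₁ ≠ e₂ ∧ e₁ ≠ e₃ ∧ e₂ ≠ e₃ ∧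
    g₁ ∉ A.E ∧ g₂ ∉ A.E ∧ g₁ ≠ g₂ ∧
    A.lo e₁ = some v₁ ∧ A.lo e₂ = some v₁ ∧
    A.up e = some v₁ ∧ A.lo e = some v₂ ∧ A.lo e₃ = some v₂ ∧
    B.V = insert v₃ A.V ∧
    B.E = insert g₁ (insert g₂ (A.E.erase e)) ∧
    B.η = Function.update (Function.update A.η v₁ .acUp) v₃ .aiUp ∧
    B.up = Function.update (Function.update A.up g₁ (some v₁)) g₂ (some v₁) ∧
    B.lo = Function.update (Function.update (Function.update
      (Function.update (Function.update A.lo e₁ (some v₂)) e₂ (some v₃))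
        e₃ (some v₁)) g₁ (some v₂)) g₂ (some v₃)

/-- Rule `i↓-c↑` (dual of `c↓-i↑`). -/
def RedIdCu (A B : PreFlow) : Prop :=
  ∃ v₁ v₂ v₃ e e₁ e₂ e₃ g₁ g₂,
    v₁ ∈ A.V ∧ v₂ ∈ A.V ∧ v₁ ≠ v₂ ∧ v₃ ∉ A.V ∧
    A.η v₁ = .acUp ∧ A.η v₂ = .aiDown ∧
    e ∈ A.E ∧ e₁ ∈ A.E ∧ e₂ ∈ A.E ∧ e₃ ∈ A.E ∧
    e ≠ e₁ ∧ e ≠ e₂ ∧ e ≠ e₃ ∧ e₁ ≠ e₂ ∧ e₁ ≠ e₃ ∧ e₂ ≠ e₃ ∧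
    g₁ ∉ A.E ∧ g₂ ∉ A.E ∧ g₁ ≠ g₂ ∧
    A.up e₁ = some v₁ ∧ A.up e₂ = some v₁ ∧
    A.lo e = some v₁ ∧ A.up e = some v₂ ∧ A.up e₃ = some v₂ ∧
    B.V = insert v₃ A.V ∧
    B.E = insert g₁ (insert g₂ (A.E.erase e)) ∧
    B.η = Function.update (Function.update A.η v₁ .acDown) v₃ .aiDown ∧
    B.lo = Function.update (Function.update A.lo g₁ (some v₁)) g₂ (some v₁) ∧
    B.up = Function.update (Function.update (Function.update
      (Function.update (Function.update A.up e₁ (some v₂)) e₂ (some v₃))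
        e₃ (some v₁)) g₁ (some v₂)) g₂ (some v₃)

/-- Rule `c↓-c↑`: a contraction whose output enters a cocontraction is
replaced by two cocontractions above two contractions, crosswise connected. -/
def RedCdCu (A B : PreFlow) : Prop :=
  ∃ v₁ v₂ v₃ v₄ e e₁ e₂ e₃ e₄ g₁₁ g₁₂ g₂₁ g₂₂,
    v₁ ∈ A.V ∧ v₂ ∈ A.V ∧ v₁ ≠ v₂ ∧
    v₃ ∉ A.V ∧ v₄ ∉ A.V ∧ v₃ ≠ v₄ ∧
    A.η v₁ = .acDown ∧ A.η v₂ = .acUp ∧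
    e ∈ A.E ∧ e₁ ∈ A.E ∧ e₂ ∈ A.E ∧ e₃ ∈ A.E ∧ e₄ ∈ A.E ∧
    e ≠ e₁ ∧ e ≠ e₂ ∧ e ≠ e₃ ∧ e ≠ e₄ ∧
    e₁ ≠ e₂ ∧ e₁ ≠ e₃ ∧ e₁ ≠ e₄ ∧ e₂ ≠ e₃ ∧ e₂ ≠ e₄ ∧ e₃ ≠ e₄ ∧
    g₁₁ ∉ A.E ∧ g₁₂ ∉ A.E ∧ g₂₁ ∉ A.E ∧ g₂₂ ∉ A.E ∧
    g₁₁ ≠ g₁₂ ∧ g₁₁ ≠ g₂₁ ∧ g₁₁ ≠ g₂₂ ∧ g₁₂ ≠ g₂₁ ∧ g₁₂ ≠ g₂₂ ∧ g₂₁ ≠ g₂₂ ∧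
    A.lo e₁ = some v₁ ∧ A.lo e₂ = some v₁ ∧ A.up e = some v₁ ∧
    A.lo e = some v₂ ∧ A.up e₃ = some v₂ ∧ A.up e₄ = some v₂ ∧
    B.V = insert v₃ (insert v₄ A.V) ∧
    B.E = insert g₁₁ (insert g₁₂ (insert g₂₁ (insert g₂₂ (A.E.erase e)))) ∧
    B.η = Function.update (Function.update (Function.update
      (Function.update A.η v₁ .acUp) v₂ .acUp) v₃ .acDown) v₄ .acDown ∧
    B.up = Function.update (Function.update (Function.update
      (Function.update (Function.update (Function.update A.up
        e₃ (some v₃)) e₄ (some v₄)) g₁₁ (some v₁)) g₁₂ (some v₁))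
          g₂₁ (some v₂)) g₂₂ (some v₂) ∧
    B.lo = Function.update (Function.update (Function.update
      (Function.update (Function.update A.lo e₂ (some v₂)) g₁₁ (some v₃))
        g₁₂ (some v₄)) g₂₁ (some v₃)) g₂₂ (some v₄)

/-- One step of the flow rewriting system `w`. -/
def StepW (A B : PreFlow) : Prop :=
  RedWdCd A B ∨ RedCuWu A B ∨ RedWdIu A B ∨ RedIdWu A B ∨
  RedWdWu A B ∨ RedWdCu A B ∨ RedCdWu A B

/-- One step of the flow rewriting system `c`. -/
def StepC (A B : PreFlow) : Prop :=
  RedCdIu A B ∨ RedIdCu A B ∨ RedCdCu A B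

/-- `A` is normal for the flow rewriting system `w`. -/
def NormalW (A : PreFlow) : Prop := ¬ ∃ B, StepW A B

/-- `A` is normal for the flow rewriting system `c`. -/
def NormalC (A : PreFlow) : Prop := ¬ ∃ B, StepC A B

/-! ### Flow isomorphisms. -/

structure FlowIso (A B : PreFlow) : Type where
  vmap : ℕ → ℕ
  emap : ℕ → ℕ
  vbij : Set.BijOn vmap (A.V : Set ℕ) (B.V : Set ℕ)
  ebij : Set.BijOn emap (A.E : Set ℕ) (B.E : Set ℕ)
  lab : ∀ v ∈ A.V, B.η (vmap v) = A.η v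
  upc : ∀ e ∈ A.E, B.up (emap e) = (A.up e).map vmap
  loc : ∀ e ∈ A.E, B.lo (emap e) = (A.lo e).map vmap

/-! ### The global reduction `→se` (elimination of a simple edge). -/

/-- The flow obtained from `B` by eliminating the simple edge `e0` between
the interaction `vi` and the cointeraction `vc` (with `e2` the other lower
edge of `vi` and `e3` the other upper edge of `vc`): two copies (tags `0`,
hat, the lower one, and `1`, tilde, the upper one) of the remaining flow are
glued by identifying the hat copy of `e2` with the tilde copy of `e3`; a
weakening (vertex `(2,0)`) is placed above the tilde copy of `e2`, a
coweakening (vertex `(2,1)`) below the hat copy of `e3`; each upper edge `ε`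
of `B` gives a cocontraction (vertex `(3,ε)`, with a new upper edge `(3,ε)`)
joining the two copies of `ε`, and dually each lower edge `ε'` of `B` gives
a contraction (vertex `(4,ε')`, with a new lower edge `(4,ε')`). -/
def seFlow (B : PreFlow) (vi vc e0 e2 e3 : ℕ) : PreFlow :=
  { V := ((B.V.erase vi).erase vc).image (Nat.pair 0) ∪
         ((B.V.erase vi).erase vc).image (Nat.pair 1) ∪
         {Nat.pair 2 0, Nat.pair 2 1} ∪
         (B.E.filter (fun e => B.up e = none)).image (Nat.pair 3) ∪
         (B.E.filter (fun e => B.lo e = none)).image (Nat.pair 4),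
    E := (B.E.erase e0).image (Nat.pair 0) ∪
         (B.E.erase e0).image (fun e => if e = e3 then Nat.pair 0 e2 else Nat.pair 1 e) ∪
         (B.E.filter (fun e => B.up e = none)).image (Nat.pair 3) ∪
         (B.E.filter (fun e => B.lo e = none)).image (Nat.pair 4),
    η := fun x =>
      if (Nat.unpair x).1 = 2 then
        (if (Nat.unpair x).2 = 0 then FlowLabel.awDown else FlowLabel.awUp)
      else if (Nat.unpair x).1 = 3 then FlowLabel.acUp
      else if (Nat.unpair x).1 = 4 then FlowLabel.acDown
      else B.η (Nat.unpair x).2,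
    up := fun x =>
      let t := (Nat.unpair x).1
      let y := (Nat.unpair x).2
      if t = 0 then
        (if y = e2 then
          (match B.up e3 with
           | some v => some (Nat.pair 1 v)
           | none => some (Nat.pair 3 e3))
        else
          (match B.up y with
           | some v => some (Nat.pair 0 v)
           | none => some (Nat.pair 3 y)))
      else if t = 1 then
        (if y = e2 then some (Nat.pair 2 0)
        else
          (match B.up y with
           | some v => some (Nat.pair 1 v)
           | none => some (Nat.pair 3 y)))
      else if t = 3 then none
      else some (Nat.pair 4 y),
    lo := fun x =>
      let t := (Nat.unpair x).1
      let y := (Nat.unpair x).2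
      if t = 0 then
        (if y = e2 then
          (match B.lo e2 with
           | some v => some (Nat.pair 0 v)
           | none => some (Nat.pair 4 e2))
        else if y = e3 then some (Nat.pair 2 1)
        else
          (match B.lo y with
           | some v => some (Nat.pair 0 v)
           | none => some (Nat.pair 4 y)))
      else if t = 1 then
        (match B.lo y with
         | some v => some (Nat.pair 1 v)
         | none => some (Nat.pair 4 y))
      else if t = 3 then some (Nat.pair 3 y)
      else none }

/-- The reduction `→se`: elimination of a simple edge (up to flow
isomorphism). -/
def RedSE (B C : PreFlow) : Prop :=
  ∃ vi vc e0 e2 e3,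
    vi ∈ B.V ∧ vc ∈ B.V ∧ vi ≠ vc ∧
    B.η vi = .aiDown ∧ B.η vc = .aiUp ∧
    e0 ∈ B.E ∧ e2 ∈ B.E ∧ e3 ∈ B.E ∧
    e0 ≠ e2 ∧ e0 ≠ e3 ∧ e2 ≠ e3 ∧
    B.up e0 = some vi ∧ B.lo e0 = some vc ∧
    B.up e2 = some vi ∧ B.lo e3 = some vc ∧
    Nonempty (FlowIso C (seFlow B vi vc e0 e2 e3))

/-! ### The atomic flow associated with a derivation. -/

/-- Correspondence conditions for a linear rule applied at position `q`:
for each pair `(c₁, c₂)` in `cs`, occurrences at `q ++ c₁ ++ p` in the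
conclusion (formula `i+1`) are traced to occurrences at `q ++ c₂ ++ p` in
the premiss (formula `i`). -/
def corrCond (f : ℕ → List Bool → ℕ) (i : ℕ) (q : List Bool) (ψ : Formula)
    (cs : List (List Bool × List Bool)) : Prop :=
  ∀ c ∈ cs, ∀ p : List Bool, ψ.IsOcc (q ++ c.1 ++ p) →
    f (i + 1) (q ++ c.1 ++ p) = f i (q ++ c.2 ++ p)

/-- The tracing conditions for one inference step: occurrences in the
context are traced to the same edge, and the active occurrences of a
structural rule are related to the edges of the vertex `v` as prescribed by
its label, while the active occurrences of logical and `=` steps are traced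
to the same edges under the canonical correspondence. -/
def stepCond (A : PreFlow) (f : ℕ → List Bool → ℕ) (v : ℕ) (i : ℕ)
    (r : RuleName) (q : List Bool) (φ ψ : Formula) : Prop :=
  (∀ p, ¬ (q <+: p) → φ.IsOcc p → f (i + 1) p = f i p) ∧
  match r with
  | .aiDown =>
      A.η v = .aiDown ∧
      A.up (f (i + 1) (q ++ [false])) = some v ∧
      A.up (f (i + 1) (q ++ [true])) = some v ∧
      f (i + 1) (q ++ [false]) ≠ f (i + 1) (q ++ [true])
  | .aiUp =>
      A.η v = .aiUp ∧
      A.lo (f i (q ++ [false])) = some v ∧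
      A.lo (f i (q ++ [true])) = some v ∧
      f i (q ++ [false]) ≠ f i (q ++ [true])
  | .awDown => A.η v = .awDown ∧ A.up (f (i + 1) q) = some v
  | .awUp => A.η v = .awUp ∧ A.lo (f i q) = some v
  | .acDown =>
      A.η v = .acDown ∧
      A.lo (f i (q ++ [false])) = some v ∧
      A.lo (f i (q ++ [true])) = some v ∧
      A.up (f (i + 1) q) = some v ∧
      f i (q ++ [false]) ≠ f i (q ++ [true])
  | .acUp =>
      A.η v = .acUp ∧
      A.lo (f i q) = some v ∧
      A.up (f (i + 1) (q ++ [false])) = some v ∧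
      A.up (f (i + 1) (q ++ [true])) = some v ∧
      f (i + 1) (q ++ [false]) ≠ f (i + 1) (q ++ [true])
  | .s => corrCond f i q ψ
      [([false, false], [false]), ([false, true], [true, false]),
       ([true], [true, true])]
  | .m => corrCond f i q ψ
      [([false, false], [false, false]), ([true, false], [false, true]),
       ([false, true], [true, false]), ([true, true], [true, true])]
  | .eqOrComm => corrCond f i q ψ [([false], [true]), ([true], [false])]
  | .eqAndComm => corrCond f i q ψ [([false], [true]), ([true], [false])]
  | .eqOrAssocL => corrCond f i q ψ
      [([false], [false, false]), ([true, false], [false, true]),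
       ([true, true], [true])]
  | .eqOrAssocR => corrCond f i q ψ
      [([false, false], [false]), ([false, true], [true, false]),
       ([true], [true, true])]
  | .eqAndAssocL => corrCond f i q ψ
      [([false], [false, false]), ([true, false], [false, true]),
       ([true, true], [true])]
  | .eqAndAssocR => corrCond f i q ψ
      [([false, false], [false]), ([false, true], [true, false]),
       ([true], [true, true])]
  | .eqOrUnitDel => corrCond f i q ψ [([], [false])]
  | .eqOrUnitAdd => corrCond f i q ψ [([false], [])]
  | .eqAndUnitDel => corrCond f i q ψ [([], [false])]
  | .eqAndUnitAdd => corrCond f i q ψ [([false], [])]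
  | .eqTTDel => True
  | .eqTTAdd => True
  | .eqFFDel => True
  | .eqFFAdd => True

/-- `A` is the atomic flow associated with the derivation `Φ`, where `f`
maps each atom occurrence (formula index, position) of `Φ` to an edge of
`A`, and `g` assigns to each structural inference step its vertex. -/
def IsAssocFlow (Φ : Deriv) (A : PreFlow) (f : ℕ → List Bool → ℕ)
    (g : ℕ → ℕ) : Prop :=
  Φ.WF ∧ A.IsFlow ∧
  (∀ i p, i < Φ.nf → (Φ.fml i).IsOcc p → f i p ∈ A.E) ∧
  (∀ e ∈ A.E, ∃ i p, i < Φ.nf ∧ (Φ.fml i).IsOcc p ∧ f i p = e) ∧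
  (∀ i p p', i < Φ.nf → (Φ.fml i).IsOcc p → (Φ.fml i).IsOcc p' →
    f i p = f i p' → p = p') ∧
  (∀ p, (Φ.fml 0).IsOcc p → A.up (f 0 p) = none) ∧
  (∀ p, (Φ.fml Φ.steps.length).IsOcc p → A.lo (f Φ.steps.length p) = none) ∧
  (∀ i, i < Φ.steps.length → (Φ.stepAt i).1.isStructural = true → g i ∈ A.V) ∧
  (∀ v ∈ A.V, ∃ i, i < Φ.steps.length ∧
    (Φ.stepAt i).1.isStructural = true ∧ g i = v) ∧
  (∀ i j, i < Φ.steps.length → j < Φ.steps.length →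
    (Φ.stepAt i).1.isStructural = true → (Φ.stepAt j).1.isStructural = true →
    g i = g j → i = j) ∧
  (∀ i, i < Φ.steps.length →
    stepCond A f (g i) i (Φ.stepAt i).1 (Φ.stepAt i).2.1
      (Φ.fml i) (Φ.fml (i + 1)))

/-! ### Streamlining. -/

/-- No path from an interaction or weakening vertex to a cointeraction or
coweakening vertex. -/
def NoIWPath (A : PreFlow) : Prop :=
  ¬ ∃ v v' l, v ∈ A.V ∧ v' ∈ A.V ∧
      (A.η v = .aiDown ∨ A.η v = .awDown) ∧
      (A.η v' = .aiUp ∨ A.η v' = .awUp) ∧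
      IsPath A (.ver v) (.ver v') l

/-- `Φ` is a streamlined derivation. -/
def Streamlined (Φ : Deriv) : Prop :=
  ∃ A f g, IsAssocFlow Φ A f g ∧ NoIWPath A

/-- `Φ` is a super-streamlined derivation. -/
def SuperStreamlined (Φ : Deriv) : Prop :=
  ∃ A f g, IsAssocFlow Φ A f g ∧ NoIWPath A ∧ NormalW A

/-- `Φ` is a hyper-streamlined derivation. -/
def HyperStreamlined (Φ : Deriv) : Prop :=
  ∃ A f g, IsAssocFlow Φ A f g ∧ NoIWPath A ∧ NormalW A ∧ NormalC A

end AF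

namespace AF

namespace PreFlow

/-- The endpoint an edge points to when positive edges are directed downwards and negative
edges upwards. -/
def head (F : PreFlow) (π : ℕ → Bool) (e : ℕ) : Option ℕ := if π e then F.lo e else F.up e

/-- The endpoint an edge starts from when positive edges are directed downwards and negative
edges upwards. -/
def tail (F : PreFlow) (π : ℕ → Bool) (e : ℕ) : Option ℕ := if π e then F.up e else F.lo e

/-- Edge `b` directly follows edge `a` in the orientation given by `π`. -/
def Follows (F : PreFlow) (π : ℕ → Bool) (a b : ℕ) : Prop :=
  a ∈ F.E ∧ b ∈ F.E ∧ ∃ v ∈ F.V, F.head π a = some v ∧ F.tail π b = some v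

/-- A flow whose orientation admits a strictly increasing ranking of the edges. -/
def Ranked (F : PreFlow) : Prop :=
  F.degOK ∧ F.endpointsOK ∧ ∃ (π : ℕ → Bool) (r : ℕ → ℕ), F.PolarityOK π ∧
    ∀ a b, F.Follows π a b → r a < r b

variable {F : PreFlow}

theorem mem_Ledges {v e : ℕ} : e ∈ F.Ledges v ↔ e ∈ F.E ∧ F.up e = some v := by
  simp [Ledges]

theorem mem_Uedges {v e : ℕ} : e ∈ F.Uedges v ↔ e ∈ F.E ∧ F.lo e = some v := by
  simp [Uedges]

theorem mem_edges {v e : ℕ} :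
    e ∈ F.edges v ↔ e ∈ F.E ∧ (F.up e = some v ∨ F.lo e = some v) := by
  simp only [edges, Finset.mem_union, mem_Ledges, mem_Uedges]
  tauto

theorem degOK.Uedges_eq_empty (hd : F.degOK) {v : ℕ} (hv : v ∈ F.V)
    (hl : F.η v = .aiDown) : F.Uedges v = ∅ := by
  simpa [hl, labDeg] using (hd v hv).2

theorem degOK.Ledges_eq_empty (hd : F.degOK) {v : ℕ} (hv : v ∈ F.V)
    (hl : F.η v = .aiUp) : F.Ledges v = ∅ := by
  simpa [hl, labDeg] using (hd v hv).1

theorem Uedges_eq_pair {v a b : ℕ} (h : (F.Uedges v).card = 2)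
    (ha : a ∈ F.E) (hb : b ∈ F.E) (hab : a ≠ b) (hav : F.lo a = some v) (hbv : F.lo b = some v) :
    F.Uedges v = {a, b} := by
  refine (Finset.eq_of_subset_of_card_le ?_ ?_).symm
  · simp [Finset.insert_subset_iff, mem_Uedges, *]
  · rw [h, Finset.card_pair hab]

theorem Ledges_eq_pair {v a b : ℕ} (h : (F.Ledges v).card = 2)
    (ha : a ∈ F.E) (hb : b ∈ F.E) (hab : a ≠ b) (hav : F.up a = some v) (hbv : F.up b = some v) :
    F.Ledges v = {a, b} := by
  refine (Finset.eq_of_subset_of_card_le ?_ ?_).symm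
  · simp [Finset.insert_subset_iff, mem_Ledges, *]
  · rw [h, Finset.card_pair hab]

theorem Uedges_eq_singleton {v a : ℕ} (h : (F.Uedges v).card = 1)
    (ha : a ∈ F.E) (hav : F.lo a = some v) : F.Uedges v = {a} := by
  refine (Finset.eq_of_subset_of_card_le ?_ ?_).symm
  · simp [mem_Uedges, *]
  · rw [h, Finset.card_singleton]

theorem Ledges_eq_singleton {v a : ℕ} (h : (F.Ledges v).card = 1)
    (ha : a ∈ F.E) (hav : F.up a = some v) : F.Ledges v = {a} := by
  refine (Finset.eq_of_subset_of_card_le ?_ ?_).symm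
  · simp [mem_Ledges, *]
  · rw [h, Finset.card_singleton]

/-- The two edges of an interaction or cointeraction have opposite polarities. -/
theorem PolarityOK.ne_of_ai {π : ℕ → Bool} (hp : F.PolarityOK π) (hd : F.degOK) {v a b : ℕ}
    (hv : v ∈ F.V) (hl : F.η v = .aiDown ∨ F.η v = .aiUp) (ha : a ∈ F.edges v)
    (hb : b ∈ F.edges v) (hab : a ≠ b) : π a ≠ π b := by
  obtain ⟨x, hx, y, hy, hxy⟩ := (hp v hv).2 hl
  have hc : F.edges v = {a, b} := by
    refine (Finset.eq_of_subset_of_card_le ?_ ?_).symm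
    · simp [Finset.insert_subset_iff, *]
    · rw [Finset.card_pair hab]
      refine (Finset.card_union_le _ _).trans ?_
      rcases hl with hl | hl <;> simp [(hd v hv).1, (hd v hv).2, hl, labDeg]
  rw [hc] at hx hy
  simp only [Finset.mem_insert, Finset.mem_singleton] at hx hy
  grind

/-- Edges meeting at a vertex from above and from below have the same polarity. -/
theorem PolarityOK.eq_of_lo_of_up {π : ℕ → Bool} (hp : F.PolarityOK π) (hd : F.degOK)
    {v a b : ℕ} (hv : v ∈ F.V) (ha : a ∈ F.E) (hb : b ∈ F.E)
    (hav : F.lo a = some v) (hbv : F.up b = some v) : π a = π b := by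
  have h1 : a ∈ F.Uedges v := mem_Uedges.2 ⟨ha, hav⟩
  have h2 : b ∈ F.Ledges v := mem_Ledges.2 ⟨hb, hbv⟩
  have c1 := Finset.card_pos.2 ⟨a, h1⟩
  have c2 := Finset.card_pos.2 ⟨b, h2⟩
  rw [(hd v hv).2] at c1
  rw [(hd v hv).1] at c2
  refine (hp v hv).1 ?_ a (mem_edges.2 ⟨ha, .inr hav⟩) b (mem_edges.2 ⟨hb, .inl hbv⟩)
  cases hl : F.η v <;> simp_all [labDeg]

end PreFlow

theorem isDownPath_iff {F : PreFlow} {ν ν' : VPt} {l : List ℕ} :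
    IsDownPath F ν ν' l ↔ l ≠ [] ∧ (∀ e ∈ l, e ∈ F.E) ∧
      l.IsChain (fun a b => ∃ v ∈ F.V, F.lo a = some v ∧ F.up b = some v) ∧
      (∀ e ∈ l.head?, srcOK F ν e) ∧ ∀ e ∈ l.getLast?, tgtOK F ν' e := by
  unfold IsDownPath
  rw [List.isChain_iff_getElem]
  refine and_congr_right fun hl => and_congr_right fun _ => and_congr ?_ (and_congr ?_ ?_)
  · refine forall_congr' fun i => forall_congr' fun hi => ?_
    rw [List.getD_eq_getElem _ _ hi, List.getD_eq_getElem _ _ (by omega)]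
  · obtain ⟨a, l, rfl⟩ := List.exists_cons_of_ne_nil hl
    simp
  · rw [List.getLast?_eq_getElem?, List.getD_eq_getElem?_getD]
    have : l.length - 1 < l.length := by
      have := List.length_pos_iff.2 hl
      omega
    simp [this]

/-- A nonempty walk along the orientation `π`, from `ν` to `ν'` when these are vertices. -/
def Walk (F : PreFlow) (π : ℕ → Bool) (ν ν' : VPt) (l : List ℕ) : Prop :=
  l ≠ [] ∧ (∀ e ∈ l, e ∈ F.E) ∧ l.IsChain (F.Follows π) ∧
    (∀ e ∈ l.head?, ∀ v, ν = .ver v → F.tail π e = some v) ∧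
    ∀ e ∈ l.getLast?, ∀ v, ν' = .ver v → F.head π e = some v

section walks

variable {F : PreFlow} {π : ℕ → Bool} {ν ν' : VPt} {l : List ℕ}

theorem IsDownPath.walk (hd : F.degOK) (hp : F.PolarityOK π) (h : IsDownPath F ν ν' l) :
    Walk F π ν ν' l ∨ Walk F π ν' ν l.reverse := by
  obtain ⟨hne, hE, hc, hs, ht⟩ := isDownPath_iff.1 h
  have key : ∀ l : List ℕ, (∀ e ∈ l, e ∈ F.E) →
      l.IsChain (fun a b => ∃ v ∈ F.V, F.lo a = some v ∧ F.up b = some v) →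
      (l.IsChain (F.Follows π) ∧ ∀ e ∈ l, π e = true) ∨
      (l.IsChain (flip (F.Follows π)) ∧ ∀ e ∈ l, π e = false) := by
    intro l hE hc
    induction l with
    | nil => simp
    | cons a l ih =>
      cases l with
      | nil => cases ha : π a <;> simp [ha]
      | cons b l =>
        rw [List.isChain_cons_cons] at hc
        obtain ⟨⟨v, hv, hav, hbv⟩, hc⟩ := hc
        have ha : a ∈ F.E := hE a (by simp)
        have hb : b ∈ F.E := hE b (by simp)
        have hab := hp.eq_of_lo_of_up hd hv ha hb hav hbv
        refine (ih (fun e he => hE e (by simp [he])) hc).imp ?_ ?_ <;> rintro ⟨h1, h2⟩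
        · have h3 := h2 b (by simp)
          refine ⟨List.isChain_cons_cons.2 ⟨⟨ha, hb, v, hv, ?_⟩, h1⟩, ?_⟩
          · simp [PreFlow.head, PreFlow.tail, hab, h3, hav, hbv]
          · simpa [hab, h3] using h2
        · have h3 := h2 b (by simp)
          refine ⟨List.isChain_cons_cons.2 ⟨⟨hb, ha, v, hv, ?_⟩, h1⟩, ?_⟩
          · simp [PreFlow.head, PreFlow.tail, hab, h3, hav, hbv]
          · simpa [hab, h3] using h2
  refine (key l hE hc).imp ?_ ?_ <;> rintro ⟨h1, h2⟩
  · refine ⟨hne, hE, h1, fun e he v hv => ?_, fun e he v hv => ?_⟩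
    · have := hs e he
      simpa [PreFlow.tail, h2 e (List.mem_of_mem_head? he), srcOK, hv] using this
    · have := ht e he
      simpa [PreFlow.head, h2 e (List.mem_of_mem_getLast? he), tgtOK, hv] using this
  · refine ⟨by simpa using hne, by simpa using hE, List.isChain_reverse.2 h1, ?_, ?_⟩
    · intro e he v hv
      rw [List.head?_reverse] at he
      have := ht e he
      simpa [PreFlow.tail, h2 e (List.mem_of_mem_getLast? he), tgtOK, hv] using this
    · intro e he v hv
      rw [List.getLast?_reverse] at he
      have := hs e he
      simpa [PreFlow.head, h2 e (List.mem_of_mem_head? he), srcOK, hv] using this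

theorem Walk.append {v e e' : ℕ} {l₁ l₂ : List ℕ} (hv : v ∈ F.V)
    (h₁ : Walk F π ν (.ver v) (l₁ ++ [e])) (h₂ : Walk F π (.ver v) ν' (e' :: l₂)) :
    Walk F π ν ν' (l₁ ++ [e] ++ e' :: l₂) := by
  obtain ⟨-, hE₁, hc₁, hs₁, ht₁⟩ := h₁
  obtain ⟨-, hE₂, hc₂, hs₂, ht₂⟩ := h₂
  refine ⟨by simp, ?_, ?_, ?_, ?_⟩
  · intro x hx
    rcases List.mem_append.1 hx with hx | hx
    exacts [hE₁ x hx, hE₂ x hx]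
  · refine List.isChain_append.2 ⟨hc₁, hc₂, ?_⟩
    intro x hx y hy
    exact ⟨hE₁ x (List.mem_of_mem_getLast? hx), hE₂ y (List.mem_of_mem_head? hy), v, hv,
      ht₁ x hx v rfl, hs₂ y hy v rfl⟩
  · intro x hx
    refine hs₁ x ?_
    rwa [List.head?_append_of_ne_nil _ (by simp)] at hx
  · intro x hx
    refine ht₂ x ?_
    rwa [List.getLast?_append_of_ne_nil _ (by simp)] at hx

theorem AIPath.walk (hd : F.degOK) (hp : F.PolarityOK π) (h : AIPath F ν ν' l) :
    Walk F π ν ν' l ∨ Walk F π ν' ν l.reverse := by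
  induction h with
  | single h =>
    rcases h with h | h
    · exact h.walk hd hp
    · simpa [or_comm] using h.walk hd hp
  | @join ν ν' v l₁ l₂ e e' hv hl _ _ hne ih₁ ih₂ =>
    have he : ∀ x, x ∈ F.E → (F.head π x = some v ∨ F.tail π x = some v) → x ∈ F.edges v := by
      intro x hx h
      rw [PreFlow.mem_edges]
      unfold PreFlow.head PreFlow.tail at h
      grind
    have hpol : e ∈ F.edges v → e' ∈ F.edges v → π e ≠ π e' :=
      fun h h' => hp.ne_of_ai hd hv hl h h' hne
    have hU := hd.Uedges_eq_empty hv
    have hL := hd.Ledges_eq_empty hv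
    simp only [Finset.ext_iff, PreFlow.mem_Uedges, PreFlow.mem_Ledges, Finset.notMem_empty] at hU hL
    rcases ih₁ with h₁ | h₁ <;> rcases ih₂ with h₂ | h₂
    · exact .inl (h₁.append hv h₂)
    · have a1 := h₁.2.1 e (by simp)
      have a2 := h₁.2.2.2.2 e (by simp) v rfl
      have b1 := h₂.2.1 e' (by simp)
      have b2 := h₂.2.2.2.2 e' (by simp) v rfl
      have := hpol (he e a1 (.inl a2)) (he e' b1 (.inl b2))
      unfold PreFlow.head at a2 b2
      grind
    · have a1 := h₁.2.1 e (by simp)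
      have a2 := h₁.2.2.2.1 e (by simp) v rfl
      have b1 := h₂.2.1 e' (by simp)
      have b2 := h₂.2.2.2.1 e' (by simp) v rfl
      have := hpol (he e a1 (.inr a2)) (he e' b1 (.inr b2))
      unfold PreFlow.tail at a2 b2
      grind
    · refine .inr ?_
      simp only [List.reverse_append, List.reverse_cons, List.reverse_nil, List.nil_append] at h₁ h₂ ⊢
      exact h₂.append hv h₁

theorem Walk.irrefl {v : ℕ} {r : ℕ → ℕ} (hr : ∀ a b, F.Follows π a b → r a < r b)
    (hv : v ∈ F.V) : ¬ Walk F π (.ver v) (.ver v) l := by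
  rintro ⟨hne, hE, hc, hs, ht⟩
  have key : ∀ (l : List ℕ) (hne : l ≠ []), l.IsChain (F.Follows π) →
      r (l.head hne) ≤ r (l.getLast hne) := by
    intro l hne hc
    induction l with
    | nil => exact absurd rfl hne
    | cons a l ih =>
      cases l with
      | nil => simp
      | cons b l =>
        rw [List.isChain_cons_cons] at hc
        exact (hr _ _ hc.1).le.trans (by simpa using ih (by simp) hc.2)
  refine (key l hne hc).not_gt (hr _ _ ⟨hE _ (by simp), hE _ (by simp), v, hv, ?_, ?_⟩)
  · exact ht _ (by simp [List.getLast?_eq_some_getLast hne]) v rfl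
  · exact hs _ (by simp [List.head?_eq_some_head hne]) v rfl

end walks

theorem PreFlow.Ranked.cycleFree {F : PreFlow} (h : F.Ranked) : CycleFree F := by
  rintro ⟨v, l, hv, hl, -⟩
  obtain ⟨hd, -, π, r, hp, hr⟩ := h
  rcases hl.walk hd hp with h | h
  exacts [Walk.irrefl hr hv h, Walk.irrefl hr hv h]

/-- A path traversed downwards if `d` holds and upwards otherwise. -/
def IsDirPath (F : PreFlow) (d : Bool) (ν ν' : VPt) (l : List ℕ) : Prop :=
  if d then IsDownPath F ν ν' l else IsDownPath F ν' ν l.reverse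

section orientedCycles

variable {F : PreFlow} {π : ℕ → Bool}

theorem IsDirPath.isPath {d : Bool} {ν ν' : VPt} {l : List ℕ} (h : IsDirPath F d ν ν' l) :
    IsPath F ν ν' l := by
  unfold IsDirPath at h
  split_ifs at h
  exacts [.inl h, .inr h]

theorem IsDirPath.singleton {a v w : ℕ} (ha : a ∈ F.E) (ht : F.tail π a = some v)
    (hh : F.head π a = some w) : IsDirPath F (π a) (.ver v) (.ver w) [a] := by
  unfold IsDirPath
  unfold PreFlow.tail at ht
  unfold PreFlow.head at hh
  split_ifs with h <;> simp [isDownPath_iff, srcOK, tgtOK, ha] <;> simp_all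

theorem IsDirPath.cons {a b v w : ℕ} {ν' : VPt} {l : List ℕ} (ha : a ∈ F.E) (hw : w ∈ F.V)
    (ht : F.tail π a = some v) (hh : F.head π a = some w) (htb : F.tail π b = some w)
    (hab : π a = π b) (h : IsDirPath F (π b) (.ver w) ν' (b :: l)) :
    IsDirPath F (π a) (.ver v) ν' (a :: b :: l) := by
  unfold IsDirPath at h ⊢
  unfold PreFlow.tail at ht htb
  unfold PreFlow.head at hh
  rw [hab] at ht hh ⊢
  split_ifs at * with hb
  · rw [isDownPath_iff] at h ⊢
    obtain ⟨-, h1, h2, h3, h4⟩ := h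
    refine ⟨by simp, by simpa [ha] using h1, ?_, by simpa [srcOK] using ht, by simpa using h4⟩
    exact List.isChain_cons_cons.2 ⟨⟨w, hw, hh, htb⟩, h2⟩
  · rw [isDownPath_iff] at h ⊢
    obtain ⟨-, h1, h2, h3, h4⟩ := h
    rw [List.isChain_reverse] at h2 ⊢
    refine ⟨by simp, by simp at h1 ⊢; grind, ?_, by simpa using h3, by simpa [tgtOK] using ht⟩
    exact List.isChain_cons_cons.2 ⟨⟨w, hw, htb, hh⟩, h2⟩

/-- A duplicate-free oriented walk is an ai-path; moreover it starts with a path in one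
direction that ends either where the walk does or at an interaction or cointeraction. -/
theorem exists_isDirPath_of_isChain (hd : F.degOK) (hp : F.PolarityOK π) {z : ℕ} :
    ∀ {l : List ℕ} {a v : ℕ}, a ∈ F.E → F.tail π a = some v →
      (∀ x ∈ (a :: l).getLast?, F.head π x = some z) →
      (a :: l).IsChain (F.Follows π) → (a :: l).Nodup →
      AIPath F (.ver v) (.ver z) (a :: l) ∧
      ∃ ν l₁ l₂, l = l₁ ++ l₂ ∧ IsDirPath F (π a) (.ver v) ν (a :: l₁) ∧
        ((l₂ = [] ∧ ν = .ver z) ∨ ∃ w ∈ F.V, (F.η w = .aiDown ∨ F.η w = .aiUp) ∧ ν = .ver w ∧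
          l₂ ≠ [] ∧ AIPath F (.ver w) (.ver z) l₂) := by
  intro l
  induction l with
  | nil =>
    intro a v ha ht hz _ _
    have := IsDirPath.singleton ha ht (hz a (by simp))
    exact ⟨.single this.isPath, _, [], [], rfl, this, .inl ⟨rfl, rfl⟩⟩
  | cons b l ih =>
    intro a v ha ht hz hc hnd
    obtain ⟨⟨-, hb, w, hw, hah, hbt⟩, hc⟩ := List.isChain_cons_cons.1 hc
    obtain ⟨hpath, ν, l₁, l₂, rfl, hdir, htl⟩ :=
      ih hb hbt (by simpa using hz) hc (List.nodup_cons.1 hnd).2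
    have key : ∃ ν l₁' l₂', b :: (l₁ ++ l₂) = l₁' ++ l₂' ∧
        IsDirPath F (π a) (.ver v) ν (a :: l₁') ∧
        ((l₂' = [] ∧ ν = .ver z) ∨ ∃ w ∈ F.V, (F.η w = .aiDown ∨ F.η w = .aiUp) ∧ ν = .ver w ∧
          l₂' ≠ [] ∧ AIPath F (.ver w) (.ver z) l₂') := by
      by_cases hai : F.η w = .aiDown ∨ F.η w = .aiUp
      · exact ⟨_, [], b :: (l₁ ++ l₂), rfl, .singleton ha ht hah,
          .inr ⟨w, hw, hai, rfl, by simp, hpath⟩⟩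
      · have hab : π a = π b := by
          have ha' : a ∈ F.edges w := by
            rw [PreFlow.mem_edges]
            unfold PreFlow.head at hah
            grind
          have hb' : b ∈ F.edges w := by
            rw [PreFlow.mem_edges]
            unfold PreFlow.tail at hbt
            grind
          have hcard := hd w hw
          by_cases hcon : F.η w = .acDown ∨ F.η w = .acUp
          · exact (hp w hw).1 hcon a ha' b hb'
          · have h1 : (F.edges w).card ≤ 1 := by
              refine (Finset.card_union_le _ _).trans ?_
              rw [hcard.1, hcard.2]
              cases hl : F.η w <;> simp_all [labDeg]
            rw [Finset.card_le_one.1 h1 a ha' b hb']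
        exact ⟨ν, b :: l₁, l₂, rfl, hdir.cons ha hw ht hah hbt hab, htl⟩
    refine ⟨?_, key⟩
    obtain ⟨ν, l₁', l₂', hl, hdir, htl⟩ := key
    rw [hl] at hnd ⊢
    rcases htl with ⟨rfl, rfl⟩ | ⟨w, hw, hai, rfl, hne, hpath⟩
    · simpa using AIPath.single hdir.isPath
    · obtain ⟨c, l₂', rfl⟩ := List.exists_cons_of_ne_nil hne
      rw [← List.cons_append] at hnd ⊢
      obtain ⟨s, e, hs⟩ := (a :: l₁').eq_nil_or_concat'.resolve_left (by simp)
      rw [hs] at hdir hnd ⊢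
      refine .join hw hai (.single hdir.isPath) hpath ?_
      rintro rfl
      simp [List.nodup_append] at hnd

theorem exists_nodup_isChain {α : Type*} {R : α → α → Prop} {a b : α}
    (h : Relation.ReflTransGen R a b) :
    ∃ l : List α, (a :: l).Nodup ∧ (a :: l).IsChain R ∧ (a :: l).getLast? = some b := by
  induction h using Relation.ReflTransGen.head_induction_on with
  | refl => exact ⟨[], by simp⟩
  | @head a c hac _ ih =>
    obtain ⟨l, hnd, hc, hlast⟩ := ih
    by_cases ha : a ∈ c :: l
    · obtain ⟨s, t, hst⟩ := List.append_of_mem ha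
      rw [hst] at hnd hc hlast
      refine ⟨t, (List.nodup_append.1 hnd).2.1, (List.isChain_append.1 hc).2.1, ?_⟩
      rwa [List.getLast?_append_of_ne_nil _ (by simp)] at hlast
    · exact ⟨c :: l, List.nodup_cons.2 ⟨ha, hnd⟩, List.isChain_cons_cons.2 ⟨hac, hc⟩,
        by simpa using hlast⟩

theorem CycleFree.not_transGen_self (hd : F.degOK) (hp : F.PolarityOK π) (hcf : CycleFree F)
    (a : ℕ) : ¬ Relation.TransGen (F.Follows π) a a := by
  intro h
  obtain ⟨b, hab, hba⟩ := Relation.TransGen.head'_iff.1 h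
  obtain ⟨ha, hb, v, hv, hah, hbt⟩ := hab
  obtain ⟨l, hnd, hc, hlast⟩ := exists_nodup_isChain hba
  refine hcf ⟨v, b :: l, hv, (exists_isDirPath_of_isChain hd hp hb hbt ?_ hc hnd).1, hnd⟩
  rintro x hx
  rw [hlast, Option.mem_some_iff] at hx
  exact hx ▸ hah

theorem PreFlow.IsFlow.ranked (hF : F.IsFlow) (hcf : CycleFree F) : F.Ranked := by
  classical
  obtain ⟨hd, he, -, π, hp⟩ := hF
  refine ⟨hd, he, π, fun b => (F.E.filter fun a => Relation.TransGen (F.Follows π) a b).card,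
    hp, fun a b hab => Finset.card_lt_card (Finset.ssubset_iff_of_subset ?_ |>.2 ⟨a, ?_, ?_⟩)⟩
  · intro x hx
    rw [Finset.mem_filter] at hx ⊢
    exact ⟨hx.1, hx.2.tail hab⟩
  · exact Finset.mem_filter.2 ⟨hab.1, .single hab⟩
  · simp [hcf.not_transGen_self hd hp]

end orientedCycles

open PreFlow

/-- The ranking condition at a vertex with upper edges `U` and lower edges `L`. -/
def RankedAt (U L : Finset ℕ) (π : ℕ → Bool) (r : ℕ → ℕ) : Prop :=
  (∀ a ∈ U, π a = true →
    (∀ b ∈ L, π b = true → r a < r b) ∧ ∀ b ∈ U, π b = false → r a < r b) ∧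
  ∀ a ∈ L, π a = false →
    (∀ b ∈ U, π b = false → r a < r b) ∧ ∀ b ∈ L, π b = true → r a < r b

theorem RankedAt.congr {F : PreFlow} {v : ℕ} {π π' : ℕ → Bool} {r r' : ℕ → ℕ}
    (h : RankedAt (F.Uedges v) (F.Ledges v) π r) (he : ∀ x ∈ F.E, π' x = π x ∧ r' x = r x) :
    RankedAt (F.Uedges v) (F.Ledges v) π' r' := by
  simp only [RankedAt, mem_Uedges, mem_Ledges] at h ⊢
  grind

theorem PreFlow.follows_lt_iff {F : PreFlow} {π : ℕ → Bool} {r : ℕ → ℕ} :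
    (∀ a b, F.Follows π a b → r a < r b) ↔
      ∀ v ∈ F.V, RankedAt (F.Uedges v) (F.Ledges v) π r := by
  simp only [RankedAt, mem_Uedges, mem_Ledges, Follows, head, tail]
  constructor
  · intro h v hv
    refine ⟨fun a ha hπ => ⟨fun b hb hb' => ?_, fun b hb hb' => ?_⟩,
      fun a ha hπ => ⟨fun b hb hb' => ?_, fun b hb hb' => ?_⟩⟩ <;>
    exact h a b ⟨ha.1, hb.1, v, hv, by simp [hπ, ha.2], by simp [hb', hb.2]⟩
  · rintro h a b ⟨ha, hb, v, hv, h1, h2⟩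
    obtain ⟨h3, h4⟩ := h v hv
    cases hπ : π a <;> cases hb' : π b <;>
      simp only [hπ, hb', if_true, Bool.false_eq_true, if_false] at h1 h2
    · exact (h4 a ⟨ha, h1⟩ hπ).1 b ⟨hb, h2⟩ hb'
    · exact (h4 a ⟨ha, h1⟩ hπ).2 b ⟨hb, h2⟩ hb'
    · exact (h3 a ⟨ha, h1⟩ hπ).2 b ⟨hb, h2⟩ hb'
    · exact (h3 a ⟨ha, h1⟩ hπ).1 b ⟨hb, h2⟩ hb'

theorem PreFlow.Ranked.of_redCdIu {A B : PreFlow} (hA : A.Ranked) (h : RedCdIu A B) :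
    B.Ranked := by
  obtain ⟨hd, he, π, r, hp, hr⟩ := hA
  rw [follows_lt_iff] at hr
  obtain ⟨v₁, v₂, v₃, e, e₁, e₂, e₃, g₁, g₂, hv₁, hv₂, ne₁₂, hv₃, hη₁, hη₂, hE, hE₁, hE₂, hE₃,
    h01, h02, h03, h12, h13, h23, hg₁, hg₂, hg, hl₁, hl₂, hu, hl, hl₃, hV, hBE, hη, hup, hlo⟩ := h
  have hr₁ := hr v₁ hv₁
  have hr₂ := hr v₂ hv₂
  have AU₁ := Uedges_eq_pair (by simp [(hd v₁ hv₁).2, hη₁, labDeg]) hE₁ hE₂ h12 hl₁ hl₂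
  have AL₁ := Ledges_eq_singleton (by simp [(hd v₁ hv₁).1, hη₁, labDeg]) hE hu
  have AU₂ := Uedges_eq_pair (by simp [(hd v₂ hv₂).2, hη₂, labDeg]) hE hE₃ h03 hl hl₃
  have AL₂ := hd.Ledges_eq_empty hv₂ hη₂
  have π₁ : π e₁ = π e := hp.eq_of_lo_of_up hd hv₁ hE₁ hE hl₁ hu
  have π₂ : π e₂ = π e := hp.eq_of_lo_of_up hd hv₁ hE₂ hE hl₂ hu
  have π₃ : π e ≠ π e₃ := hp.ne_of_ai hd hv₂ (.inr hη₂) (mem_edges.2 ⟨hE, .inr hl⟩)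
    (mem_edges.2 ⟨hE₃, .inr hl₃⟩) h03
  rw [AU₁, AL₁] at hr₁
  rw [AU₂, AL₂] at hr₂
  simp only [Finset.ext_iff, mem_Uedges, mem_Ledges, Finset.mem_insert, Finset.mem_singleton,
    Finset.notMem_empty] at AU₁ AL₁ AU₂ AL₂
  have mBE : ∀ x, x ∈ B.E ↔ x = g₁ ∨ x = g₂ ∨ (x ≠ e ∧ x ∈ A.E) := by simp [hBE]
  have mBV : ∀ x, x ∈ B.V ↔ x = v₃ ∨ x ∈ A.V := by simp [hV]
  have dup : ∀ x, B.up x = if x = g₂ then some v₁ else if x = g₁ then some v₁ else A.up x := by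
    simp [hup, Function.update_apply]
  have dlo : ∀ x, B.lo x = if x = g₂ then some v₃ else if x = g₁ then some v₂ else
      if x = e₃ then some v₁ else if x = e₂ then some v₃ else if x = e₁ then some v₂ else
      A.lo x := by
    simp [hlo, Function.update_apply]
  have dη : ∀ v, B.η v = if v = v₃ then .aiUp else if v = v₁ then .acUp else A.η v := by
    simp [hη, Function.update_apply]
  have ne₁₃ : v₁ ≠ v₃ := by grind
  have ne₂₃ : v₂ ≠ v₃ := by grind
  have ne : ∀ x ∈ A.E, x ≠ g₁ ∧ x ≠ g₂ := by grind
  obtain ⟨n₁, n₁'⟩ := ne e₁ hE₁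
  obtain ⟨n₂, n₂'⟩ := ne e₂ hE₂
  obtain ⟨n₃, n₃'⟩ := ne e₃ hE₃
  clear hV hBE hη hup hlo
  have BL₁ : B.Ledges v₁ = {g₁, g₂} := by
    ext x; simp [mem_Ledges]; grind
  have BU₁ : B.Uedges v₁ = {e₃} := by
    ext x; simp [mem_Uedges]; grind
  have BL₂ : B.Ledges v₂ = ∅ := by
    ext x; simp [mem_Ledges]; grind
  have BU₂ : B.Uedges v₂ = {e₁, g₁} := by
    ext x; simp [mem_Uedges]; grind
  have BL₃ : B.Ledges v₃ = ∅ := by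
    ext x; simp [mem_Ledges]; grind [endpointsOK]
  have BU₃ : B.Uedges v₃ = {e₂, g₂} := by
    ext x; simp [mem_Uedges]; grind [endpointsOK]
  have BL : ∀ v ∈ A.V, v ≠ v₁ → v ≠ v₂ → B.Ledges v = A.Ledges v := by
    intro v hv h1 h2
    ext x; simp [mem_Ledges]; grind
  have BU : ∀ v ∈ A.V, v ≠ v₁ → v ≠ v₂ → B.Uedges v = A.Uedges v := by
    intro v hv h1 h2
    ext x; simp [mem_Uedges]; grind
  refine ⟨?_, ?_, fun x => if x = g₁ ∨ x = g₂ then !π e else π x,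
    fun x => if x = g₁ ∨ x = g₂ then r e else r x, ?_, ?_⟩
  · intro v hv
    by_cases h1 : v = v₁
    · subst h1
      grind [labDeg, Finset.card_pair]
    by_cases h2 : v = v₂
    · subst h2
      grind [labDeg, Finset.card_pair]
    by_cases h3 : v = v₃
    · subst h3
      grind [labDeg, Finset.card_pair]
    have hv : v ∈ A.V := by grind
    rw [BL v hv h1 h2, BU v hv h1 h2, show B.η v = A.η v by grind]
    exact hd v hv
  · intro x hx
    have := he x
    grind
  · intro v hv
    by_cases h1 : v = v₁
    · subst h1
      have hc : ∀ x ∈ B.edges v, (if x = g₁ ∨ x = g₂ then !π e else π x) = !π e := by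
        simp only [edges, BL₁, BU₁]
        grind
      exact ⟨fun _ a ha b hb => (hc a ha).trans (hc b hb).symm, by simp [dη, ne₁₃]⟩
    by_cases h2 : v = v₂
    · subst h2
      exact ⟨by simp [dη, ne₂₃, ne₁₂.symm, hη₂],
        fun _ => ⟨e₁, by simp [edges, BU₂], g₁, by simp [edges, BU₂], by simp [n₁, n₁', π₁]⟩⟩
    by_cases h3 : v = v₃
    · subst h3
      exact ⟨by simp [dη],
        fun _ => ⟨e₂, by simp [edges, BU₃], g₂, by simp [edges, BU₃], by simp [n₂, n₂', π₂]⟩⟩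
    have hv : v ∈ A.V := by grind
    have hm : ∀ x ∈ A.edges v, (if x = g₁ ∨ x = g₂ then !π e else π x) = π x := fun x hx => by
      simp [ne x (mem_edges.1 hx).1]
    rw [edges, BL v hv h1 h2, BU v hv h1 h2, ← edges, show B.η v = A.η v by simp [dη, h1, h3]]
    refine ⟨fun h a ha b hb => ?_, fun h => ?_⟩
    · exact ((hm a ha).trans ((hp v hv).1 h a ha b hb)).trans (hm b hb).symm
    · obtain ⟨a, ha, b, hb, hab⟩ := (hp v hv).2 h
      exact ⟨a, ha, b, hb, (hm a ha).trans_ne (hab.trans_eq (hm b hb).symm)⟩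
  · rw [follows_lt_iff]
    intro v hv
    have π₃' : π e₃ = !π e := Bool.eq_not.2 π₃.symm
    simp only [RankedAt, Finset.mem_insert, Finset.mem_singleton, forall_eq_or_imp, forall_eq,
      Finset.notMem_empty, false_imp_iff, imp_true_iff, π₁, π₂, π₃'] at hr₁ hr₂
    by_cases h1 : v = v₁
    · subst h1
      simp only [RankedAt, BL₁, BU₁, Finset.mem_insert, Finset.mem_singleton, forall_eq_or_imp,
        forall_eq, n₃, n₃', π₃', true_or, or_true, or_false, if_true, if_false]
      cases h : π e <;> simp_all
    by_cases h2 : v = v₂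
    · subst h2
      simp only [RankedAt, BL₂, BU₂, Finset.mem_insert, Finset.mem_singleton, forall_eq_or_imp,
        forall_eq, n₁, n₁', π₁, true_or, or_false, if_true, if_false]
      cases h : π e <;> simp_all
    by_cases h3 : v = v₃
    · subst h3
      simp only [RankedAt, BL₃, BU₃, Finset.mem_insert, Finset.mem_singleton, forall_eq_or_imp,
        forall_eq, n₂, n₂', π₂, or_true, or_false, if_true, if_false]
      cases h : π e <;> simp_all
    have hv : v ∈ A.V := by grind
    rw [BL v hv h1 h2, BU v hv h1 h2]
    exact (hr v hv).congr fun x hx => by simp [ne x hx]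

/-- The label of a vertex after turning the flow upside down. -/
def FlowLabel.flip : FlowLabel → FlowLabel
  | .aiDown => .aiUp
  | .aiUp => .aiDown
  | .awDown => .awUp
  | .awUp => .awDown
  | .acDown => .acUp
  | .acUp => .acDown

/-- The flow turned upside down. -/
def PreFlow.flip (F : PreFlow) : PreFlow := ⟨F.V, F.E, fun v => (F.η v).flip, F.lo, F.up⟩

theorem PreFlow.Ranked.flip {F : PreFlow} (h : F.Ranked) : F.flip.Ranked := by
  obtain ⟨hd, he, π, r, hp, hr⟩ := h
  refine ⟨fun v hv => ?_, fun x hx => (he x hx).symm, fun x => !π x, r, fun v hv => ?_,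
    fun a b ⟨ha, hb, v, hv, h1, h2⟩ => hr a b ⟨ha, hb, v, hv, ?_, ?_⟩⟩
  · have := hd v hv
    change (F.Uedges v).card = (labDeg (F.η v).flip).1 ∧
      (F.Ledges v).card = (labDeg (F.η v).flip).2
    cases h : F.η v <;> simp_all [labDeg, FlowLabel.flip]
  · have := hp v hv
    have h1 : F.flip.edges v = F.edges v := Finset.union_comm _ _
    rw [h1]
    change ((F.η v).flip = _ ∨ (F.η v).flip = _ → _) ∧ ((F.η v).flip = _ ∨ (F.η v).flip = _ → _)
    cases h : F.η v <;> simp_all [FlowLabel.flip] <;> exact this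
  · cases h : π a <;> simpa [PreFlow.flip, head, h] using h1
  · cases h : π b <;> simpa [PreFlow.flip, tail, h] using h2

theorem RedIdCu.flip {A B : PreFlow} (h : RedIdCu A B) : RedCdIu A.flip B.flip := by
  obtain ⟨v₁, v₂, v₃, e, e₁, e₂, e₃, g₁, g₂, hv₁, hv₂, hv₁₂, hv₃, hη₁, hη₂, hE, hE₁, hE₂, hE₃,
    h01, h02, h03, h12, h13, h23, hg₁, hg₂, hg, hl₁, hl₂, hu, hl, hl₃, hV, hBE, hη, hlo, hup⟩ := h
  refine ⟨v₁, v₂, v₃, e, e₁, e₂, e₃, g₁, g₂, hv₁, hv₂, hv₁₂, hv₃, ?_, ?_, hE, hE₁, hE₂, hE₃,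
    h01, h02, h03, h12, h13, h23, hg₁, hg₂, hg, hl₁, hl₂, hu, hl, hl₃, hV, hBE, ?_, hlo, hup⟩
  · simp [PreFlow.flip, hη₁, FlowLabel.flip]
  · simp [PreFlow.flip, hη₂, FlowLabel.flip]
  · ext v
    simp only [PreFlow.flip, hη, Function.update_apply]
    split_ifs <;> rfl

theorem PreFlow.Ranked.of_redIdCu {A B : PreFlow} (hA : A.Ranked) (h : RedIdCu A B) :
    B.Ranked := by
  have := (hA.flip.of_redCdIu h.flip).flip
  have hB : B.flip.flip = B := by
    obtain ⟨V, E, η, up, lo⟩ := B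
    simp only [PreFlow.flip, PreFlow.mk.injEq, true_and, and_true]
    funext v
    cases η v <;> rfl
  rwa [hB] at this

theorem PreFlow.Ranked.of_redCdCu {A B : PreFlow} (hA : A.Ranked) (h : RedCdCu A B) :
    B.Ranked := by
  obtain ⟨hd, he, π, r, hp, hr⟩ := hA
  rw [follows_lt_iff] at hr
  obtain ⟨v₁, v₂, v₃, v₄, e, e₁, e₂, e₃, e₄, g₁₁, g₁₂, g₂₁, g₂₂, hv₁, hv₂, ne₁₂, hv₃, hv₄, ne₃₄,
    hη₁, hη₂, hE, hE₁, hE₂, hE₃, hE₄, h01, h02, h03, h04, h12, h13, h14, h23, h24, h34,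
    hg₁₁, hg₁₂, hg₂₁, hg₂₂, d1, d2, d3, d4, d5, d6, hl₁, hl₂, hu, hl, hu₃, hu₄,
    hV, hBE, hη, hup, hlo⟩ := h
  have hr₁ := hr v₁ hv₁
  have hr₂ := hr v₂ hv₂
  have AU₁ := Uedges_eq_pair (by simp [(hd v₁ hv₁).2, hη₁, labDeg]) hE₁ hE₂ h12 hl₁ hl₂
  have AL₁ := Ledges_eq_singleton (by simp [(hd v₁ hv₁).1, hη₁, labDeg]) hE hu
  have AU₂ := Uedges_eq_singleton (by simp [(hd v₂ hv₂).2, hη₂, labDeg]) hE hl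
  have AL₂ := Ledges_eq_pair (by simp [(hd v₂ hv₂).1, hη₂, labDeg]) hE₃ hE₄ h34 hu₃ hu₄
  have π₁ : π e₁ = π e := hp.eq_of_lo_of_up hd hv₁ hE₁ hE hl₁ hu
  have π₂ : π e₂ = π e := hp.eq_of_lo_of_up hd hv₁ hE₂ hE hl₂ hu
  have π₃ : π e₃ = π e := (hp.eq_of_lo_of_up hd hv₂ hE hE₃ hl hu₃).symm
  have π₄ : π e₄ = π e := (hp.eq_of_lo_of_up hd hv₂ hE hE₄ hl hu₄).symm
  rw [AU₁, AL₁] at hr₁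
  rw [AU₂, AL₂] at hr₂
  simp only [Finset.ext_iff, mem_Uedges, mem_Ledges, Finset.mem_insert,
    Finset.mem_singleton] at AU₁ AL₁ AU₂ AL₂
  have mBE : ∀ x, x ∈ B.E ↔ x = g₁₁ ∨ x = g₁₂ ∨ x = g₂₁ ∨ x = g₂₂ ∨ (x ≠ e ∧ x ∈ A.E) := by
    simp [hBE]
  have mBV : ∀ x, x ∈ B.V ↔ x = v₃ ∨ x = v₄ ∨ x ∈ A.V := by simp [hV]
  have dup : ∀ x, B.up x = if x = g₂₂ then some v₂ else if x = g₂₁ then some v₂ else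
      if x = g₁₂ then some v₁ else if x = g₁₁ then some v₁ else
      if x = e₄ then some v₄ else if x = e₃ then some v₃ else A.up x := by
    simp [hup, Function.update_apply]
  have dlo : ∀ x, B.lo x = if x = g₂₂ then some v₄ else if x = g₂₁ then some v₃ else
      if x = g₁₂ then some v₄ else if x = g₁₁ then some v₃ else
      if x = e₂ then some v₂ else A.lo x := by
    simp [hlo, Function.update_apply]
  have dη : ∀ v, B.η v = if v = v₄ then .acDown else if v = v₃ then .acDown else
      if v = v₂ then .acUp else if v = v₁ then .acUp else A.η v := by
    simp [hη, Function.update_apply]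
  have ne : ∀ x ∈ A.E, x ≠ g₁₁ ∧ x ≠ g₁₂ ∧ x ≠ g₂₁ ∧ x ≠ g₂₂ := by grind
  clear hV hBE hη hup hlo
  have BL₁ : B.Ledges v₁ = {g₁₁, g₁₂} := by
    ext x; simp [mem_Ledges]; grind
  have BU₁ : B.Uedges v₁ = {e₁} := by
    ext x; simp [mem_Uedges]; grind
  have BL₂ : B.Ledges v₂ = {g₂₁, g₂₂} := by
    ext x; simp [mem_Ledges]; grind
  have BU₂ : B.Uedges v₂ = {e₂} := by
    ext x; simp [mem_Uedges]; grind
  have BL₃ : B.Ledges v₃ = {e₃} := by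
    ext x; simp [mem_Ledges]; grind [endpointsOK]
  have BU₃ : B.Uedges v₃ = {g₁₁, g₂₁} := by
    ext x; simp [mem_Uedges]; grind [endpointsOK]
  have BL₄ : B.Ledges v₄ = {e₄} := by
    ext x; simp [mem_Ledges]; grind [endpointsOK]
  have BU₄ : B.Uedges v₄ = {g₁₂, g₂₂} := by
    ext x; simp [mem_Uedges]; grind [endpointsOK]
  have BL : ∀ v ∈ A.V, v ≠ v₁ → v ≠ v₂ → B.Ledges v = A.Ledges v := by
    intro v hv h1 h2
    ext x; simp [mem_Ledges]; grind
  have BU : ∀ v ∈ A.V, v ≠ v₁ → v ≠ v₂ → B.Uedges v = A.Uedges v := by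
    intro v hv h1 h2
    ext x; simp [mem_Uedges]; grind
  obtain ⟨m1, m2, m3, m4⟩ := ne e₁ hE₁
  obtain ⟨n1, n2, n3, n4⟩ := ne e₂ hE₂
  obtain ⟨p1, p2, p3, p4⟩ := ne e₃ hE₃
  obtain ⟨q1, q2, q3, q4⟩ := ne e₄ hE₄
  refine ⟨?_, ?_, fun x => if x = g₁₁ ∨ x = g₁₂ ∨ x = g₂₁ ∨ x = g₂₂ then π e else π x,
    fun x => if x = g₁₁ ∨ x = g₁₂ ∨ x = g₂₁ ∨ x = g₂₂ then r e else r x, ?_, ?_⟩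
  · intro v hv
    by_cases h1 : v = v₁
    · subst h1
      grind [labDeg, Finset.card_pair]
    by_cases h2 : v = v₂
    · subst h2
      grind [labDeg, Finset.card_pair]
    by_cases h3 : v = v₃
    · subst h3
      grind [labDeg, Finset.card_pair]
    by_cases h4 : v = v₄
    · subst h4
      grind [labDeg, Finset.card_pair]
    have hv : v ∈ A.V := by grind
    rw [BL v hv h1 h2, BU v hv h1 h2, show B.η v = A.η v by grind]
    exact hd v hv
  · intro x hx
    have := he x
    grind
  · intro v hv
    by_cases h1 : v = v₁
    · subst h1
      have hc : ∀ x ∈ B.edges v, (if x = g₁₁ ∨ x = g₁₂ ∨ x = g₂₁ ∨ x = g₂₂ then π e else π x) =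
          π e := by
        simp only [edges, BL₁, BU₁]
        grind
      exact ⟨fun _ a ha b hb => (hc a ha).trans (hc b hb).symm, by grind⟩
    by_cases h2 : v = v₂
    · subst h2
      have hc : ∀ x ∈ B.edges v, (if x = g₁₁ ∨ x = g₁₂ ∨ x = g₂₁ ∨ x = g₂₂ then π e else π x) =
          π e := by
        simp only [edges, BL₂, BU₂]
        grind
      exact ⟨fun _ a ha b hb => (hc a ha).trans (hc b hb).symm, by grind⟩
    by_cases h3 : v = v₃
    · subst h3
      have hc : ∀ x ∈ B.edges v, (if x = g₁₁ ∨ x = g₁₂ ∨ x = g₂₁ ∨ x = g₂₂ then π e else π x) =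
          π e := by
        simp only [edges, BL₃, BU₃]
        grind
      exact ⟨fun _ a ha b hb => (hc a ha).trans (hc b hb).symm, by grind⟩
    by_cases h4 : v = v₄
    · subst h4
      have hc : ∀ x ∈ B.edges v, (if x = g₁₁ ∨ x = g₁₂ ∨ x = g₂₁ ∨ x = g₂₂ then π e else π x) =
          π e := by
        simp only [edges, BL₄, BU₄]
        grind
      exact ⟨fun _ a ha b hb => (hc a ha).trans (hc b hb).symm, by grind⟩
    have hv : v ∈ A.V := by grind
    have hm : ∀ x ∈ A.edges v,
        (if x = g₁₁ ∨ x = g₁₂ ∨ x = g₂₁ ∨ x = g₂₂ then π e else π x) = π x := fun x hx => by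
      simp [ne x (mem_edges.1 hx).1]
    rw [edges, BL v hv h1 h2, BU v hv h1 h2, ← edges, show B.η v = A.η v by
      simp [dη, h1, h2, h3, h4]]
    refine ⟨fun h a ha b hb => ?_, fun h => ?_⟩
    · exact ((hm a ha).trans ((hp v hv).1 h a ha b hb)).trans (hm b hb).symm
    · obtain ⟨a, ha, b, hb, hab⟩ := (hp v hv).2 h
      exact ⟨a, ha, b, hb, (hm a ha).trans_ne (hab.trans_eq (hm b hb).symm)⟩
  · rw [follows_lt_iff]
    intro v hv
    simp only [RankedAt, Finset.mem_insert, Finset.mem_singleton, forall_eq_or_imp, forall_eq,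
      π₁, π₂, π₃, π₄] at hr₁ hr₂
    by_cases h1 : v = v₁
    · subst h1
      simp only [RankedAt, BL₁, BU₁, Finset.mem_insert, Finset.mem_singleton, forall_eq_or_imp,
        forall_eq, m1, m2, m3, m4, π₁, true_or, or_true, or_false, if_true, if_false]
      cases h : π e <;> simp_all
    by_cases h2 : v = v₂
    · subst h2
      simp only [RankedAt, BL₂, BU₂, Finset.mem_insert, Finset.mem_singleton, forall_eq_or_imp,
        forall_eq, n1, n2, n3, n4, π₂, true_or, or_true, or_false, if_true, if_false]
      cases h : π e <;> simp_all
    by_cases h3 : v = v₃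
    · subst h3
      simp only [RankedAt, BL₃, BU₃, Finset.mem_insert, Finset.mem_singleton, forall_eq_or_imp,
        forall_eq, p1, p2, p3, p4, π₃, true_or, or_true, or_false, if_true, if_false]
      cases h : π e <;> simp_all
    by_cases h4 : v = v₄
    · subst h4
      simp only [RankedAt, BL₄, BU₄, Finset.mem_insert, Finset.mem_singleton, forall_eq_or_imp,
        forall_eq, q1, q2, q3, q4, π₄, true_or, or_true, or_false, if_true, if_false]
      cases h : π e <;> simp_all
    have hv : v ∈ A.V := by grind
    rw [BL v hv h1 h2, BU v hv h1 h2]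
    exact (hr v hv).congr fun x hx => by simp [ne x hx]

/-- If an atomic flow `A` is cycle-free and `A →c* B`,
then `B` is cycle-free. -/
theorem statement_10 (A B : PreFlow) (hA : A.IsFlow) (hcf : CycleFree A)
    (h : Relation.ReflTransGen StepC A B) : CycleFree B := by
  suffices B.Ranked from this.cycleFree
  induction h with
  | refl => exact hA.ranked hcf
  | tail _ hs ih =>
    rcases hs with hs | hs | hs
    · exact ih.of_redCdIu hs
    · exact ih.of_redIdCu hs
    · exact ih.of_redCdCu hs

end AF
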